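/- arXiv:2105.07766 — 2 statements merged into one kernel-verified Lean document; each statement's English description precedes it below -/
import Mathlib

section
/- Let f : [0,∞) → ℝ be continuous with f(x)/(1+x²) convergent as x → ∞. If lim_{y→∞} A₂'(y)/A₂(y) = 1 and lim_{y→∞} A₂''(y)/A₂(y) = 1, then L_n^{(ν₁,ν₂)}(f; x) → f(x) uniformly as n → ∞ on every compact subset of [0,∞). -/
/-- Data for generalized Brenke polynomials: analytic functions `A₁, A₂, h`
given by power series on `{t : |t| < R}` (`R > 1`), with `A₁, A₂ > 0` on `ℝ`,
`h'(1) = 1`, and polynomials `p k` satisfying the generating relation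
`A₁(h(t)) · A₂(x · h(t)) = ∑ₖ p k x · tᵏ` with `p k x ≥ 0` for `x ≥ 0`. -/
structure BrenkeData where
  R : ℝ
  A₁ : ℝ → ℝ
  A₂ : ℝ → ℝ
  h : ℝ → ℝ
  a₁ : ℕ → ℝ
  a₂ : ℕ → ℝ
  c : ℕ → ℝ
  p : ℕ → ℝ → ℝ
  hR : 1 < R
  ha₁ : a₁ 0 ≠ 0
  ha₂ : ∀ k, a₂ k ≠ 0
  hc0 : c 0 = 0
  hc1 : c 1 ≠ 0
  hA₁ : ∀ t : ℝ, |t| < R → HasSum (fun k => a₁ k * t ^ k) (A₁ t)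
  hA₂ : ∀ t : ℝ, |t| < R → HasSum (fun k => a₂ k * t ^ k) (A₂ t)
  hh : ∀ t : ℝ, |t| < R → HasSum (fun k => c k * t ^ k) (h t)
  hA₁pos : ∀ t : ℝ, 0 < A₁ t
  hA₂pos : ∀ t : ℝ, 0 < A₂ t
  hh1 : deriv h 1 = 1
  hgen : ∀ x t : ℝ, |t| < R → HasSum (fun k => p k x * t ^ k) (A₁ (h t) * A₂ (x * h t))
  hpos : ∀ (k : ℕ) (x : ℝ), 0 ≤ x → 0 ≤ p k x

/-- The Stancu type operator `L_n^{(ν₁,ν₂)}` including generalized Brenke polynomials. -/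
noncomputable def stancuL (B : BrenkeData) (ν₁ ν₂ : ℝ) (n : ℕ) (f : ℝ → ℝ) (x : ℝ) : ℝ :=
  (B.A₁ (B.h 1) * B.A₂ (n * x * B.h 1))⁻¹ *
    ∑' k : ℕ, B.p k (n * x) * f ((k + ν₁) / (n + ν₂))

open Filter Topology in
/-- Termwise differentiation of a real power series. -/
lemma ps_deriv {R : ℝ} {a : ℕ → ℝ} {g : ℝ → ℝ}
    (hg : ∀ t : ℝ, |t| < R → HasSum (fun k => a k * t ^ k) (g t)) (t : ℝ) (ht : |t| < R) :
    HasDerivAt g (deriv g t) t ∧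
      HasSum (fun k : ℕ => ((k + 1 : ℝ) * a (k + 1)) * t ^ k) (deriv g t) := by
  obtain ⟨r, htr, hrR⟩ := exists_between ht
  obtain ⟨r', hrr', hr'R⟩ := exists_between hrR
  have h0 : 0 ≤ |t| := abs_nonneg t
  have hr0 : 0 < r := by linarith
  have hr'0 : 0 < r' := by linarith
  have hs : Summable (fun k => |a k * r' ^ k|) :=
    (hg r' (by rwa [abs_of_pos hr'0])).summable.abs
  have hbd : ∀ k, |a k * r' ^ k| ≤ ∑' k, |a k * r' ^ k| :=
    fun k => hs.le_tsum k (fun _ _ => abs_nonneg _)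
  set M := ∑' k, |a k * r' ^ k| with hM
  have hq : ‖r / r'‖ < 1 := by
    rw [Real.norm_eq_abs, abs_of_pos (by positivity), div_lt_one hr'0]; exact hrr'
  have hu : Summable (fun k : ℕ => M / r * ((k : ℝ) ^ 1 * (r / r') ^ k)) :=
    (summable_pow_mul_geometric_of_norm_lt_one 1 hq).mul_left _
  have hbound : ∀ (k : ℕ) (y : ℝ), y ∈ Metric.ball (0 : ℝ) r →
      ‖a k * ((k : ℝ) * y ^ (k - 1))‖ ≤ M / r * ((k : ℝ) ^ 1 * (r / r') ^ k) := by
    intro k y hy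
    have hy' : |y| < r := by simpa using hy
    rcases k with _ | k
    · simp
    · have h1 : |y| ^ k ≤ r ^ k := pow_le_pow_left₀ (abs_nonneg _) hy'.le k
      have h2 := hbd (k + 1)
      rw [abs_mul, abs_of_pos (pow_pos hr'0 _), ← le_div_iff₀ (pow_pos hr'0 _)] at h2
      simp only [Real.norm_eq_abs, abs_mul, abs_pow, Nat.add_sub_cancel, Nat.abs_cast, pow_one]
      calc |a (k+1)| * (((k + 1 : ℕ) : ℝ) * |y| ^ k)
          ≤ (M / r' ^ (k+1)) * (((k + 1 : ℕ) : ℝ) * r ^ k) := by gcongr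
        _ = M / r * (((k + 1 : ℕ) : ℝ) * (r / r') ^ (k+1)) := by
            rw [div_pow]; field_simp; ring
  have hder : ∀ (k : ℕ) (y : ℝ), y ∈ Metric.ball (0 : ℝ) r →
      HasDerivAt (fun y => a k * y ^ k) (a k * ((k : ℝ) * y ^ (k - 1))) y := by
    intro k y _
    exact (hasDerivAt_pow k y).const_mul (a k)
  have htb : t ∈ Metric.ball (0 : ℝ) r := by simpa using htr
  have hD := hasDerivAt_tsum_of_isPreconnected hu Metric.isOpen_ball
    (convex_ball (0 : ℝ) r).isPreconnected hder hbound htb (hg t ht).summable htb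
  have hgt : HasDerivAt g (∑' k : ℕ, a k * ((k : ℝ) * t ^ (k - 1))) t := by
    refine hD.congr_of_eventuallyEq ?_
    filter_upwards [Metric.isOpen_ball.mem_nhds htb] with y hy
    have hy' : |y| < r := by simpa using hy
    exact (hg y (hy'.trans hrR)).tsum_eq.symm
  rw [hgt.deriv]
  refine ⟨hgt, ?_⟩
  have hsum : Summable (fun k : ℕ => a k * ((k : ℝ) * t ^ (k - 1))) :=
    Summable.of_norm_bounded hu (fun k => hbound k t htb)
  have h3 := (hasSum_nat_add_iff' 1).mpr hsum.hasSum
  simp only [Finset.sum_range_one, Nat.cast_zero, zero_mul, mul_zero, sub_zero] at h3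
  refine h3.congr_fun ?_ |> fun h => h
  intro k
  simp only [Nat.add_sub_cancel]; push_cast; ring

lemma ps_zero {a : ℕ → ℝ} {v : ℝ} (h : HasSum (fun k => a k * (0 : ℝ) ^ k) v) : a 0 = v := by
  have h2 : HasSum (fun k => a k * (0 : ℝ) ^ k) (a 0 * (0 : ℝ) ^ 0) :=
    hasSum_single 0 (fun k hk => by simp [hk])
  have := h2.unique h
  simpa using this

/-- Uniqueness of power series coefficients. -/
lemma ps_unique {r : ℝ} (hr : 0 < r) (k : ℕ) : ∀ (a b : ℕ → ℝ) (g : ℝ → ℝ),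
    (∀ t : ℝ, |t| < r → HasSum (fun k => a k * t ^ k) (g t)) →
    (∀ t : ℝ, |t| < r → HasSum (fun k => b k * t ^ k) (g t)) → a k = b k := by
  induction k with
  | zero =>
    intro a b g ha hb
    rw [ps_zero (ha 0 (by simpa)), ps_zero (hb 0 (by simpa))]
  | succ k ih =>
    intro a b g ha hb
    have := ih _ _ (deriv g) (fun t ht => (ps_deriv ha t ht).2) (fun t ht => (ps_deriv hb t ht).2)
    have hk : (k + 1 : ℝ) ≠ 0 := by positivity
    exact mul_left_cancel₀ hk this

namespace BrenkeData

lemma h_zero (B : BrenkeData) : B.h 0 = 0 := by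
  rw [← ps_zero (B.hh 0 (by simpa using (zero_lt_one.trans B.hR))), B.hc0]

lemma R_pos (B : BrenkeData) : 0 < B.R := zero_lt_one.trans B.hR

/-- The function `A₁ ∘ h` as a power series. -/
lemma alpha_series (B : BrenkeData) (t : ℝ) (ht : |t| < B.R) :
    HasSum (fun k => (B.p k 0 / B.A₂ 0) * t ^ k) (B.A₁ (B.h t)) := by
  have h1 := (B.hgen 0 t ht).div_const (B.A₂ 0)
  rw [zero_mul, mul_div_assoc, div_self (B.hA₂pos 0).ne', mul_one] at h1
  refine h1.congr_fun ?_ |> fun h => h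
  intro k; ring

lemma h_hasDeriv (B : BrenkeData) (t : ℝ) (ht : |t| < B.R) : HasDerivAt B.h (deriv B.h t) t :=
  (ps_deriv B.hh t ht).1

lemma h_deriv_zero (B : BrenkeData) : deriv B.h 0 = B.c 1 := by
  have := ps_zero (ps_deriv B.hh 0 (by simpa using B.R_pos)).2
  simpa using this.symm

lemma alpha_cont (B : BrenkeData) (t : ℝ) (ht : |t| < B.R) :
    ContinuousAt (fun t => B.A₁ (B.h t)) t :=
  (ps_deriv B.alpha_series t ht).1.continuousAt

lemma F_cont (B : BrenkeData) (x t : ℝ) (ht : |t| < B.R) :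
    ContinuousAt (fun t => B.A₁ (B.h t) * B.A₂ (x * B.h t)) t :=
  (ps_deriv (B.hgen x) t ht).1.continuousAt

lemma h_strict (B : BrenkeData) : HasStrictDerivAt B.h (B.c 1) 0 := by
  have h0 : |(0 : ℝ)| < B.R := by simpa using B.R_pos
  rw [← B.h_deriv_zero]
  have hnear : ∀ᶠ t in nhds (0 : ℝ), |t| < B.R :=
    (continuous_abs.tendsto (0 : ℝ)).eventually_lt_const h0
  refine hasStrictDerivAt_of_hasDerivAt_of_continuousAt (f' := deriv B.h) ?_ ?_
  · filter_upwards [hnear] with t ht using B.h_hasDeriv t ht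
  · exact (ps_deriv (fun t ht => (ps_deriv B.hh t ht).2) 0 h0).1.continuousAt

open Filter Topology in
/-- `A₂` is continuous on the whole line (a consequence of the generating relation). -/
lemma A₂_cont (B : BrenkeData) : Continuous B.A₂ := by
  rw [continuous_iff_continuousAt]
  intro y
  have hs := (B.h_strict.hasStrictFDerivAt_equiv B.hc1)
  set e := hs.toOpenPartialHomeomorph B.h with he
  have hcoe : ∀ t, e t = B.h t := fun t => rfl
  have h0s : (0 : ℝ) ∈ e.source := hs.mem_toOpenPartialHomeomorph_source
  have h0t : (0 : ℝ) ∈ e.target := by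
    have := e.map_source h0s
    rwa [hcoe, B.h_zero] at this
  have hsymm0 : e.symm 0 = 0 := by
    have := e.left_inv h0s
    rwa [hcoe, B.h_zero] at this
  have hψ0 : ContinuousAt e.symm 0 := e.symm.continuousAt h0t
  have hR0 : ∀ᶠ w in 𝓝 (0 : ℝ), |e.symm w| < B.R := by
    have : Tendsto (fun w => |e.symm w|) (𝓝 0) (𝓝 |e.symm 0|) := hψ0.abs
    refine this.eventually_lt_const ?_
    rw [hsymm0]; simpa using B.R_pos
  have hT0 : ∀ᶠ w in 𝓝 (0 : ℝ), w ∈ e.target := e.open_target.mem_nhds h0t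
  have hlim : Tendsto (fun x : ℝ => y / x) atTop (𝓝 0) := tendsto_const_nhds.div_atTop tendsto_id
  obtain ⟨x, ⟨hx1, hx2⟩, hx⟩ :=
    ((hlim.eventually (hR0.and hT0)).and (eventually_gt_atTop 0)).exists
  have hψ : ContinuousAt e.symm (y / x) := e.symm.continuousAt hx2
  have hdiv : ContinuousAt (fun w : ℝ => w / x) y := by fun_prop
  have hψ' : ContinuousAt (fun w : ℝ => e.symm (w / x)) y :=
    ContinuousAt.comp (f := fun w : ℝ => w / x) (g := e.symm) hψ hdiv
  have hF : ContinuousAt (fun w : ℝ => B.A₁ (B.h (e.symm (w / x))) *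
      B.A₂ (x * B.h (e.symm (w / x))) / B.A₁ (B.h (e.symm (w / x)))) y := by
    refine ContinuousAt.div ?_ ?_ (B.hA₁pos _).ne'
    · exact ContinuousAt.comp (f := fun w : ℝ => e.symm (w / x)) (B.F_cont x _ hx1) hψ'
    · exact ContinuousAt.comp (f := fun w : ℝ => e.symm (w / x)) (B.alpha_cont _ hx1) hψ'
  refine hF.congr ?_
  filter_upwards [hdiv.eventually (e.open_target.mem_nhds hx2)] with w hw
  have : B.h (e.symm (w / x)) = w / x := e.right_inv hw
  rw [this, mul_div_cancel_left₀ _ (B.hA₁pos _).ne', mul_div_cancel₀ _ hx.ne']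

open Filter Topology in
lemma key (B : BrenkeData) {S : ℝ} (hS : 0 < S) :
    (∀ k, 0 ≤ B.a₂ k * B.c 1 ^ k) ∧
    ∀ s : ℝ, |s| < S → HasSum (fun k => (B.a₂ k * B.c 1 ^ k) * s ^ k) (B.A₂ (B.c 1 * s)) := by
  have h0 : |(0 : ℝ)| < B.R := by simpa using B.R_pos
  set α0 := B.A₁ (B.h 0) with hα0
  have hα0pos : 0 < α0 := B.hA₁pos _
  -- limit of the rescaled generating function
  have hlim : ∀ s : ℝ, Tendsto (fun x : ℝ => B.A₁ (B.h (s / x)) * B.A₂ (x * B.h (s / x))) atTop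
      (𝓝 (α0 * B.A₂ (B.c 1 * s))) := by
    intro s
    have hd : Tendsto (fun x : ℝ => s / x) atTop (𝓝 0) := tendsto_const_nhds.div_atTop tendsto_id
    refine Tendsto.mul ((B.alpha_cont 0 h0).tendsto.comp hd) ?_
    refine (B.A₂_cont.tendsto _).comp ?_
    rcases eq_or_ne s 0 with rfl | hs
    · simp [B.h_zero]
    have hslope := B.h_strict.hasDerivAt.tendsto_slope_zero
    simp only [zero_add, B.h_zero, sub_zero, smul_eq_mul] at hslope
    have hd' : Tendsto (fun x : ℝ => s / x) atTop (𝓝[≠] 0) := by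
      refine tendsto_nhdsWithin_iff.mpr ⟨hd, ?_⟩
      filter_upwards [eventually_gt_atTop 0] with x hx
      exact div_ne_zero hs hx.ne'
    have h2 := (hslope.comp hd').mul_const s
    refine h2.congr' ?_
    filter_upwards [eventually_gt_atTop 0] with x hx
    simp only [Function.comp]
    field_simp
  have hser : ∀ s x : ℝ, 0 < x → |s| < B.R * x → HasSum (fun k => (B.p k x / x ^ k) * s ^ k)
      (B.A₁ (B.h (s / x)) * B.A₂ (x * B.h (s / x))) := by
    intro s x hx hs
    have := B.hgen x (s / x) (by rw [abs_div, abs_of_pos hx, div_lt_iff₀ hx]; exact hs)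
    refine this.congr_fun ?_ |> fun h => h
    intro k; rw [div_pow]; ring
  have hbig : ∀ s : ℝ, ∀ᶠ x : ℝ in atTop, 0 < x ∧ |s| < B.R * x := by
    intro s
    filter_upwards [eventually_gt_atTop 0, eventually_gt_atTop (|s| / B.R)] with x hx hx2
    refine ⟨hx, ?_⟩
    rw [div_lt_iff₀ B.R_pos] at hx2; linarith
  set M := α0 * B.A₂ (B.c 1 * S) + 1 with hM
  have hM0 : 0 < M := by have := B.hA₂pos (B.c 1 * S); positivity
  have hq : ∀ᶠ x : ℝ in atTop, ∀ k, B.p k x / x ^ k ∈ Set.Icc 0 (M / S ^ k) := by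
    filter_upwards [hbig S, (hlim S).eventually_lt_const (lt_add_one _)] with x hx hx2 k
    have hnn : ∀ k, 0 ≤ B.p k x / x ^ k := fun k =>
      div_nonneg (B.hpos k x hx.1.le) (pow_nonneg hx.1.le k)
    refine ⟨hnn k, ?_⟩
    rw [le_div_iff₀ (pow_pos hS k)]
    exact (le_hasSum (hser S x hx.1 hx.2) k
      (fun j _ => mul_nonneg (hnn j) (pow_nonneg hS.le j))).trans hx2.le
  let U : Ultrafilter ℝ := Ultrafilter.of atTop
  have hU : (U : Filter ℝ) ≤ atTop := Ultrafilter.of_le atTop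
  have hb : ∀ k, ∃ b ∈ Set.Icc 0 (M / S ^ k), Tendsto (fun x => B.p k x / x ^ k) U (𝓝 b) := by
    intro k
    have hc : IsCompact (Set.Icc 0 (M / S ^ k)) := isCompact_Icc
    obtain ⟨b, hb, hb2⟩ := hc.ultrafilter_le_nhds (U.map (fun x => B.p k x / x ^ k)) (by
      rw [le_principal_iff]
      exact hU (hq.mono fun x hx => hx k))
    exact ⟨b, hb, hb2⟩
  choose b hbmem hbt using hb
  have hbs : ∀ s : ℝ, |s| < S → HasSum (fun k => b k * s ^ k) (α0 * B.A₂ (B.c 1 * s)) := by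
    intro s hs
    have hgeo : Summable (fun k : ℕ => M * (|s| / S) ^ k) :=
      (summable_geometric_of_lt_one (by positivity) ((div_lt_one hS).mpr hs)).mul_left M
    have hbd : ∀ (c : ℝ) (k : ℕ), c ∈ Set.Icc 0 (M / S ^ k) →
        ‖c * s ^ k‖ ≤ M * (|s| / S) ^ k := by
      intro c k hc
      rw [norm_mul, Real.norm_eq_abs, abs_of_nonneg hc.1, norm_pow, Real.norm_eq_abs, div_pow]
      calc c * |s| ^ k ≤ M / S ^ k * |s| ^ k := by gcongr; exact hc.2
        _ = _ := by ring
    have ht := tendsto_tsum_of_dominated_convergence (𝓕 := (U : Filter ℝ))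
      (f := fun x k => (B.p k x / x ^ k) * s ^ k) (g := fun k => b k * s ^ k) hgeo
      (fun k => (hbt k).mul_const _) (hU (hq.mono fun x hx k => hbd _ k (hx k)))
    have ht2 : Tendsto (fun x : ℝ => ∑' k, (B.p k x / x ^ k) * s ^ k) U
        (𝓝 (α0 * B.A₂ (B.c 1 * s))) := by
      refine ((hlim s).mono_left hU).congr' (hU ?_)
      filter_upwards [hbig s] with x hx
      exact (hser s x hx.1 hx.2).tsum_eq.symm
    have hsum : Summable (fun k => b k * s ^ k) :=
      Summable.of_norm_bounded hgeo (fun k => hbd _ k (hbmem k))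
    rw [← tendsto_nhds_unique ht ht2]
    exact hsum.hasSum
  -- identification of the coefficients
  have hid : ∀ k, b k = α0 * (B.a₂ k * B.c 1 ^ k) := by
    intro k
    have hc1 : 0 < |B.c 1| := abs_pos.mpr B.hc1
    refine ps_unique (r := min S (B.R / |B.c 1|)) (lt_min hS (div_pos B.R_pos hc1)) k b
      (fun k => α0 * (B.a₂ k * B.c 1 ^ k)) (fun s => α0 * B.A₂ (B.c 1 * s))
      (fun t ht => hbs t (ht.trans_le (min_le_left _ _))) (fun t ht => ?_)
    have ht2 : |B.c 1 * t| < B.R := by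
      have := ht.trans_le (min_le_right _ _)
      rw [lt_div_iff₀ hc1] at this
      rw [abs_mul]; linarith
    refine ((B.hA₂ _ ht2).mul_left α0).congr_fun ?_ |> fun h => h
    intro k; rw [mul_pow]; ring
  refine ⟨fun k => ?_, fun s hs => ?_⟩
  · have := (hbmem k).1
    rw [hid] at this
    exact nonneg_of_mul_nonneg_right this hα0pos
  · have := (hbs s hs).div_const α0
    rw [mul_div_cancel_left₀ _ hα0pos.ne'] at this
    refine this.congr_fun ?_ |> fun h => h
    intro k; rw [hid]; field_simp

lemma A₂_entire (B : BrenkeData) (y : ℝ) : HasSum (fun k => B.a₂ k * y ^ k) (B.A₂ y) := by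
  have hS : 0 < |y / B.c 1| + 1 := by positivity
  have := (B.key hS).2 (y / B.c 1) (lt_add_one _)
  rw [mul_div_cancel₀ _ B.hc1] at this
  refine this.congr_fun ?_ |> fun h => h
  intro k
  rw [div_pow, mul_assoc, mul_div_cancel₀ _ (pow_ne_zero _ B.hc1)]

lemma d_pos (B : BrenkeData) (k : ℕ) : 0 < B.a₂ k * B.c 1 ^ k :=
  lt_of_le_of_ne ((B.key one_pos).1 k) (mul_ne_zero (B.ha₂ k) (pow_ne_zero _ B.hc1)).symm

/-- A positive series dominated along rays: `Φ(Xu) ≤ C Φ(Xv)` is impossible for `u > v ≥ 0`. -/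
lemma _root_.ray_absurd {d : ℕ → ℝ} (hd : ∀ k, 0 < d k) {Φ : ℝ → ℝ}
    (hΦ : ∀ y, HasSum (fun k => d k * y ^ k) (Φ y)) {u v C : ℝ} (hv : 0 ≤ v) (huv : v < u)
    (hC : 0 < C) (hle : ∀ X : ℝ, 0 ≤ X → Φ (X * u) ≤ C * Φ (X * v)) : False := by
  have hu : 0 < u := hv.trans_lt huv
  have hq0 : 0 ≤ v / u := by positivity
  have hq1 : v / u < 1 := (div_lt_one hu).mpr huv
  obtain ⟨N, hN⟩ := exists_pow_lt_of_lt_one (inv_pos.mpr hC) hq1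
  have hlt : ∀ k, N ≤ k → C * v ^ k < u ^ k := by
    intro k hk
    have h1 : (v / u) ^ k < C⁻¹ := (pow_le_pow_of_le_one hq0 hq1.le hk).trans_lt hN
    rw [div_pow, div_lt_iff₀ (pow_pos hu k)] at h1
    calc C * v ^ k < C * (C⁻¹ * u ^ k) := by gcongr
      _ = u ^ k := by field_simp
  set e : ℕ → ℝ := fun k => d k * (u ^ k - C * v ^ k) with he
  have hepos : ∀ k, N ≤ k → 0 < e k := fun k hk =>
    mul_pos (hd k) (sub_pos.mpr (hlt k hk))
  have hsum : ∀ X : ℝ, HasSum (fun k => e k * X ^ k) (Φ (X * u) - C * Φ (X * v)) := by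
    intro X
    refine ((hΦ (X * u)).sub ((hΦ (X * v)).mul_left C)).congr_fun ?_ |> fun h => h
    intro k; simp only [he, mul_pow]; ring
  have hpart : ∀ X : ℝ, 0 ≤ X → ∑ k ∈ Finset.range (N + 2), e k * X ^ k ≤ 0 := by
    intro X hX
    refine (sum_le_hasSum _ (fun k hk => ?_) (hsum X)).trans (sub_nonpos.mpr (hle X hX))
    have : N ≤ k := by simp at hk; omega
    exact mul_nonneg (hepos k this).le (pow_nonneg hX k)
  set D := ∑ k ∈ Finset.range (N + 1), |e k| with hD
  have hD0 : 0 ≤ D := Finset.sum_nonneg fun _ _ => abs_nonneg _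
  have heN := hepos (N + 1) (by omega)
  have hX : ∀ X : ℝ, 1 ≤ X → e (N + 1) * X ≤ D := by
    intro X hX1
    have hX0 : 0 < X := by linarith
    have h1 := hpart X hX0.le
    rw [Finset.sum_range_succ] at h1
    have h2 : -(D * X ^ N) ≤ ∑ k ∈ Finset.range (N + 1), e k * X ^ k := by
      rw [hD, Finset.sum_mul, ← Finset.sum_neg_distrib]
      refine Finset.sum_le_sum fun k hk => ?_
      have hk' : k ≤ N := by simp at hk; omega
      have h3 : X ^ k ≤ X ^ N := pow_le_pow_right₀ hX1 hk'
      have h4 : -(|e k| * X ^ k) ≤ e k * X ^ k := by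
        have := mul_le_mul_of_nonneg_right (neg_abs_le (e k)) (pow_pos hX0 k).le
        linarith
      have h5 := mul_le_mul_of_nonneg_left h3 (abs_nonneg (e k))
      linarith
    have h6 : (e (N + 1) * X) * X ^ N ≤ D * X ^ N := by
      rw [pow_succ] at h1; nlinarith
    exact le_of_mul_le_mul_right h6 (pow_pos hX0 N)
  have h7 := hX (D / e (N + 1) + 1) (by have : 0 ≤ D / e (N + 1) := by positivity
                                        linarith)
  rw [mul_add, mul_div_cancel₀ _ heN.ne'] at h7
  linarith

lemma no_decrease (B : BrenkeData) {s t : ℝ} (hs : 0 ≤ s) (hst : s < t) (ht : t < B.R)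
    (h1 : 0 ≤ B.h t / B.c 1) (h2 : B.h t / B.c 1 < B.h s / B.c 1) : False := by
  have hsR : |s| < B.R := by rw [abs_of_nonneg hs]; linarith
  have htR : |t| < B.R := by rw [abs_of_nonneg (by linarith)]; linarith
  refine ray_absurd (d := fun k => B.a₂ k * B.c 1 ^ k) (Φ := fun y => B.A₂ (B.c 1 * y)) B.d_pos
    (fun y => ?_) h1 h2 (C := B.A₁ (B.h t) / B.A₁ (B.h s))
    (div_pos (B.hA₁pos _) (B.hA₁pos _)) (fun X hX => ?_)
  · refine (B.A₂_entire (B.c 1 * y)).congr_fun ?_ |> fun h => h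
    intro k; rw [mul_pow]; ring
  · have e : ∀ r, B.c 1 * (X * (B.h r / B.c 1)) = X * B.h r := by
      intro r; field_simp [B.hc1]
    simp only [e]
    have hle := hasSum_le (fun k => mul_le_mul_of_nonneg_left
      (pow_le_pow_left₀ hs hst.le k) (B.hpos k X hX)) (B.hgen X s hsR) (B.hgen X t htR)
    rw [div_mul_eq_mul_div, le_div_iff₀ (B.hA₁pos _)]
    linarith

open Filter Topology in
lemma h_one_pos (B : BrenkeData) : 0 < B.h 1 := by
  have h1R : |(1 : ℝ)| < B.R := by simpa using B.hR
  have h1d : HasDerivAt B.h 1 1 := by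
    have := B.h_hasDeriv 1 h1R
    rwa [B.hh1] at this
  have hg0 : HasDerivAt (fun t => B.h t / B.c 1) 1 0 := by
    have := B.h_strict.hasDerivAt.div_const (B.c 1)
    rwa [div_self B.hc1] at this
  -- a small positive point with positive value
  obtain ⟨s, hs0, hs1, hs⟩ : ∃ s : ℝ, 0 < s ∧ s < 1 ∧ 0 < B.h s / B.c 1 := by
    have hsl := hg0.tendsto_slope_zero_right
    simp only [zero_add, B.h_zero, zero_div, sub_zero, smul_eq_mul] at hsl
    have hev := hsl.eventually (lt_mem_nhds zero_lt_one)
    have hlt : ∀ᶠ t : ℝ in 𝓝[>] 0, t < 1 := nhdsWithin_le_nhds (gt_mem_nhds zero_lt_one)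
    obtain ⟨s, ⟨ha, hb⟩, hc⟩ := ((hev.and hlt).and self_mem_nhdsWithin).exists
    have hc' : 0 < s := hc
    exact ⟨s, hc', hb, (pos_iff_pos_of_mul_pos ha).mp (inv_pos.mpr hc')⟩
  have hg1 : 0 < B.h 1 / B.c 1 := by
    by_contra hneg
    push Not at hneg
    have hcont : ContinuousOn (fun t => B.h t / B.c 1) (Set.Icc s 1) := by
      intro t ht
      have : |t| < B.R := by
        rw [abs_of_nonneg (by linarith [ht.1])]; linarith [ht.2, B.hR]
      exact ((B.h_hasDeriv t this).continuousAt.div_const _).continuousWithinAt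
    obtain ⟨t, ht, ht0⟩ := intermediate_value_Icc' hs1.le hcont ⟨hneg, hs.le⟩
    have ht0' : B.h t / B.c 1 = 0 := ht0
    have hne : s ≠ t := by rintro rfl; linarith
    exact B.no_decrease hs0.le (lt_of_le_of_ne ht.1 hne) (by linarith [ht.2, B.hR])
      ht0'.ge (by rw [ht0']; exact hs)
  have hc : 0 < B.c 1 := by
    by_contra hneg
    have hneg : B.c 1 < 0 := lt_of_le_of_ne (not_lt.mp hneg) B.hc1
    have hsl := h1d.tendsto_slope_zero_left
    simp only [smul_eq_mul] at hsl
    have hev := hsl.eventually (lt_mem_nhds zero_lt_one)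
    have hlt : ∀ᶠ t : ℝ in 𝓝[<] 0, -1 < t := nhdsWithin_le_nhds (lt_mem_nhds (by norm_num))
    obtain ⟨s, ⟨ha, hb⟩, hc⟩ := ((hev.and hlt).and self_mem_nhdsWithin).exists
    have hc' : s < 0 := hc
    have hd : B.h (1 + s) - B.h 1 < 0 := by
      by_contra hcon
      have := mul_nonpos_of_nonpos_of_nonneg (inv_nonpos.mpr hc'.le) (not_lt.mp hcon)
      linarith
    exact B.no_decrease (s := 1 + s) (t := 1) (by linarith) (by linarith) B.hR hg1.le
      ((div_lt_div_right_of_neg hneg).mpr (by linarith))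
  exact (div_pos_iff_of_pos_right hc).mp hg1

/-- First and second factorial moments. -/
lemma moments (B : BrenkeData) : ∃ u v w : ℝ, ∀ X : ℝ,
    HasSum (fun k : ℕ => (k : ℝ) * B.p k X)
      (u * B.A₂ (X * B.h 1) + B.A₁ (B.h 1) * (deriv B.A₂ (X * B.h 1) * X)) ∧
    HasSum (fun k : ℕ => (k : ℝ) * (k - 1) * B.p k X)
      (v * B.A₂ (X * B.h 1) + (2 * u * X + w * X) * deriv B.A₂ (X * B.h 1)
        + B.A₁ (B.h 1) * X ^ 2 * deriv (deriv B.A₂) (X * B.h 1)) := by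
  have h1R : |(1 : ℝ)| < B.R := by simpa using B.hR
  set α : ℝ → ℝ := fun t => B.A₁ (B.h t) with hα
  have dα : ∀ t, |t| < B.R → HasDerivAt α (deriv α t) t := fun t ht =>
    (ps_deriv B.alpha_series t ht).1
  have dα' := (ps_deriv (fun t ht => (ps_deriv B.alpha_series t ht).2) 1 h1R).1
  have dh' := (ps_deriv (fun t ht => (ps_deriv B.hh t ht).2) 1 h1R).1
  have dA : ∀ y, HasDerivAt B.A₂ (deriv B.A₂ y) y := fun y =>
    (ps_deriv (R := |y| + 1) (fun t _ => B.A₂_entire t) y (lt_add_one _)).1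
  have dA' : ∀ y, HasDerivAt (deriv B.A₂) (deriv (deriv B.A₂) y) y := fun y =>
    (ps_deriv (R := |y| + 1) (fun t _ => (ps_deriv (R := |t| + 1)
      (fun t _ => B.A₂_entire t) t (lt_add_one _)).2) y (lt_add_one _)).1
  refine ⟨deriv α 1, deriv (deriv α) 1, B.A₁ (B.h 1) * deriv (deriv B.h) 1, fun X => ?_⟩
  set F : ℝ → ℝ := fun t => B.A₁ (B.h t) * B.A₂ (X * B.h t) with hF
  have dXh : ∀ t, |t| < B.R → HasDerivAt (fun t => X * B.h t) (X * deriv B.h t) t := fun t ht =>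
    (B.h_hasDeriv t ht).const_mul X
  have dF : ∀ t, |t| < B.R → HasDerivAt F (deriv α t * B.A₂ (X * B.h t) +
      α t * (deriv B.A₂ (X * B.h t) * (X * deriv B.h t))) t := fun t ht =>
    (dα t ht).mul ((dA (X * B.h t)).comp t (dXh t ht))
  have hnear : ∀ᶠ t in nhds (1 : ℝ), |t| < B.R :=
    (continuous_abs.tendsto (1 : ℝ)).eventually_lt_const h1R
  have dF2 := ((dα'.mul ((dA (X * B.h 1)).comp 1 (dXh 1 h1R))).add
    ((dα 1 h1R).mul (((dA' (X * B.h 1)).comp 1 (dXh 1 h1R)).mul (dh'.const_mul X))))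
  have dF2' := (dF2.congr_of_eventuallyEq (f₁ := deriv F) (by
    filter_upwards [hnear] with t ht
    rw [(dF t ht).deriv]; rfl)).deriv
  have s1 := (ps_deriv (B.hgen X) 1 h1R).2
  have s2 := (ps_deriv (fun t ht => (ps_deriv (B.hgen X) t ht).2) 1 h1R).2
  rw [dF2'] at s2
  rw [(dF 1 h1R).deriv, B.hh1] at s1
  constructor
  · refine (hasSum_nat_add_iff' 1).mp ?_
    simp only [Finset.sum_range_one, Nat.cast_zero, zero_mul, sub_zero]
    convert s1 using 1
    · rfl
    · funext k; push_cast; ring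
    · simp only [hα]; ring
  · refine (hasSum_nat_add_iff' 2).mp ?_
    simp only [Finset.sum_range_succ, Finset.sum_range_zero, Nat.cast_zero, Nat.cast_one, zero_mul,
      sub_self, mul_zero, add_zero, sub_zero]
    convert s2 using 1
    · rfl
    · funext k; push_cast; ring
    · simp only [hα, B.hh1, Function.comp, Pi.mul_apply]; ring

lemma dA (B : BrenkeData) (y : ℝ) : HasDerivAt B.A₂ (deriv B.A₂ y) y :=
  (ps_deriv (R := |y| + 1) (fun t _ => B.A₂_entire t) y (lt_add_one _)).1

lemma dA' (B : BrenkeData) (y : ℝ) : HasDerivAt (deriv B.A₂) (deriv (deriv B.A₂) y) y :=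
  (ps_deriv (R := |y| + 1) (fun t _ => (ps_deriv (R := |t| + 1)
      (fun t _ => B.A₂_entire t) t (lt_add_one _)).2) y (lt_add_one _)).1

lemma dA'' (B : BrenkeData) (y : ℝ) : ContinuousAt (deriv (deriv B.A₂)) y :=
  (ps_deriv (R := |y| + 1) (fun t _ => (ps_deriv (R := |t| + 1) (fun t _ => (ps_deriv (R := |t| + 1)
      (fun t _ => B.A₂_entire t) t (lt_add_one _)).2) t (lt_add_one _)).2) y
      (lt_add_one _)).1.continuousAt

end BrenkeData

open Filter Topology

lemma bdd_of_tendsto {g : ℝ → ℝ} (hg : ContinuousOn g (Set.Ici 0)) {l : ℝ}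
    (hl : Tendsto g atTop (𝓝 l)) : ∃ C : ℝ, 0 ≤ C ∧ ∀ x, 0 ≤ x → |g x| ≤ C := by
  have h1 : ∀ᶠ x in atTop, |g x| < |l| + 1 := hl.abs.eventually_lt_const (lt_add_one _)
  obtain ⟨T, hT⟩ := eventually_atTop.mp h1
  obtain ⟨C, hC⟩ := (isCompact_Icc (a := (0 : ℝ)) (b := T)).exists_bound_of_continuousOn
    (hg.mono fun x hx => hx.1)
  refine ⟨max (|l| + 1) C, le_max_of_le_left (by positivity), fun x hx => ?_⟩
  rcases le_total T x with h | h
  · exact (hT x h).le.trans (le_max_left _ _)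
  · exact (hC x ⟨hx, h⟩).trans (le_max_right _ _)

lemma quad_small {q l : ℝ → ℝ} {C c : ℝ} (hC : 0 ≤ C) (hq : Tendsto q atTop (𝓝 0))
    (hqC : ∀ X, 0 ≤ X → |q X| ≤ C) (hlC : ∀ X, 0 ≤ X → |l X| ≤ C) {M ε : ℝ} (hM : 0 < M)
    (hε : 0 < ε) : ∃ N : ℕ, ∀ n : ℕ, N ≤ n → ∀ X : ℝ, 0 ≤ X → X ≤ n * M →
      X ^ 2 * q X + X * l X + c ≤ ε * n ^ 2 := by
  have h1 : ∀ᶠ X in atTop, |q X| < ε / (2 * M ^ 2) := by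
    have := hq.abs
    rw [abs_zero] at this
    exact this.eventually_lt_const (by positivity)
  obtain ⟨T, hT⟩ := eventually_atTop.mp h1
  set D := T ^ 2 * C + |c| with hD
  have hD0 : 0 ≤ D := by positivity
  obtain ⟨N, hN⟩ := exists_nat_ge (2 * (D + M * C) / ε)
  refine ⟨max N 1, fun n hn X hX hXn => ?_⟩
  have hn1 : (1 : ℝ) ≤ n := by exact_mod_cast (le_max_right N 1).trans hn
  have hnN : (N : ℝ) ≤ n := by exact_mod_cast (le_max_left N 1).trans hn
  have h2 : 2 * (D + M * C) ≤ n * ε := by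
    have := hN.trans hnN
    rwa [div_le_iff₀ hε] at this
  have h3 : X * l X ≤ n * M * C := by
    calc X * l X ≤ X * C := by gcongr; exact (le_abs_self _).trans (hlC X hX)
      _ ≤ n * M * C := by gcongr
  have h4 : X ^ 2 * q X ≤ ε / 2 * n ^ 2 + T ^ 2 * C := by
    rcases le_total T X with h | h
    · have h5 : X ^ 2 * q X ≤ (n * M) ^ 2 * (ε / (2 * M ^ 2)) := by
        calc X ^ 2 * q X ≤ X ^ 2 * (ε / (2 * M ^ 2)) := by
              gcongr; exact (le_abs_self _).trans (hT X h).le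
          _ ≤ _ := by gcongr
      have h6 : (n * M) ^ 2 * (ε / (2 * M ^ 2)) = ε / 2 * n ^ 2 := by field_simp
      have : 0 ≤ T ^ 2 * C := by positivity
      linarith
    · have h5 : X ^ 2 * q X ≤ T ^ 2 * C := by
        calc X ^ 2 * q X ≤ X ^ 2 * C := by
              gcongr; exact (le_abs_self _).trans (hqC X hX)
          _ ≤ _ := by gcongr
      have : 0 ≤ ε / 2 * (n : ℝ) ^ 2 := by positivity
      linarith
  have h7 : c ≤ |c| := le_abs_self c
  have h8 : D + n * M * C ≤ ε / 2 * n ^ 2 := by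
    have : D + n * M * C ≤ (D + M * C) * n := by nlinarith
    nlinarith
  linarith

lemma korovkin_bound {f : ℝ → ℝ} (hf : ContinuousOn f (Set.Ici 0))
    (hfE : ∃ l : ℝ, Tendsto (fun x => f x / (1 + x ^ 2)) atTop (𝓝 l)) {M ε : ℝ} (hε : 0 < ε) :
    ∃ C : ℝ, 0 ≤ C ∧ ∀ x t : ℝ, 0 ≤ x → x ≤ M → 0 ≤ t →
      |f t - f x| ≤ ε + C * (t - x) ^ 2 := by
  obtain ⟨l, hl⟩ := hfE
  obtain ⟨G, hG0, hG⟩ := bdd_of_tendsto (g := fun x => f x / (1 + x ^ 2))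
    (hf.div (by fun_prop) (fun x _ => by positivity)) hl
  have hG' : ∀ x, 0 ≤ x → |f x| ≤ G * (1 + x ^ 2) := by
    intro x hx
    have hp : 0 < 1 + x ^ 2 := by positivity
    have := hG x hx
    rwa [abs_div, abs_of_pos hp, div_le_iff₀ hp] at this
  have huc : UniformContinuousOn f (Set.Icc 0 (M + 1)) :=
    isCompact_Icc.uniformContinuousOn_of_continuous (hf.mono fun x hx => hx.1)
  obtain ⟨δ', hδ', hδ2⟩ := Metric.uniformContinuousOn_iff.mp huc ε hε
  set δ := min δ' 1
  have hδ0 : 0 < δ := lt_min hδ' one_pos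
  refine ⟨G * ((2 + 3 * M ^ 2) / δ ^ 2 + 2), by positivity, fun x t hx hxM ht => ?_⟩
  rcases lt_or_ge |t - x| δ with h | h
  · have h1 : |t - x| < 1 := h.trans_le (min_le_right _ _)
    have h2 := abs_lt.mp h1
    have := hδ2 t ⟨ht, by linarith⟩ x ⟨hx, by linarith⟩ (h.trans_le (min_le_left _ _))
    rw [Real.dist_eq] at this
    have h3 : 0 ≤ G * ((2 + 3 * M ^ 2) / δ ^ 2 + 2) * (t - x) ^ 2 := by positivity
    linarith
  · have h1 : δ ^ 2 ≤ (t - x) ^ 2 := by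
      rw [← sq_abs (t - x)]; gcongr
    have h2 : (2 + 3 * M ^ 2) ≤ (2 + 3 * M ^ 2) / δ ^ 2 * (t - x) ^ 2 := by
      rw [div_mul_eq_mul_div, le_div_iff₀ (by positivity)]
      gcongr
    have h3 : |f t - f x| ≤ |f t| + |f x| := abs_sub _ _
    have h4 := hG' t ht
    have h5 := hG' x hx
    have h6 : x ^ 2 ≤ M ^ 2 := by gcongr
    have h7 : t ^ 2 ≤ 2 * (t - x) ^ 2 + 2 * x ^ 2 := by nlinarith [sq_nonneg (t - 2 * x)]
    have h8 : G * (1 + t ^ 2) + G * (1 + x ^ 2) ≤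
        G * ((2 + 3 * M ^ 2) / δ ^ 2 * (t - x) ^ 2 + 2 * (t - x) ^ 2) := by
      rw [← mul_add]
      exact mul_le_mul_of_nonneg_left (by linarith) hG0
    have h9 : G * ((2 + 3 * M ^ 2) / δ ^ 2 + 2) * (t - x) ^ 2 =
      G * ((2 + 3 * M ^ 2) / δ ^ 2 * (t - x) ^ 2 + 2 * (t - x) ^ 2) := by ring
    linarith

/-- Uniform smallness of the second central moment. -/
lemma var_small (B : BrenkeData)
    (hA₂' : Tendsto (fun y => deriv B.A₂ y / B.A₂ y) atTop (𝓝 1))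
    (hA₂'' : Tendsto (fun y => deriv (deriv B.A₂) y / B.A₂ y) atTop (𝓝 1)) :
    ∃ V : ℝ → ℝ, (∀ X : ℝ, HasSum (fun k : ℕ => B.p k X * ((k : ℝ) - X) ^ 2)
        (B.A₁ (B.h 1) * B.A₂ (X * B.h 1) * V X)) ∧
      ∀ M ε : ℝ, 0 < M → 0 < ε → ∃ N : ℕ, ∀ n : ℕ, N ≤ n → ∀ X : ℝ, 0 ≤ X → X ≤ n * M →
        V X ≤ ε * n ^ 2 := by
  obtain ⟨u, v, w, hm⟩ := B.moments
  set β := B.A₁ (B.h 1) with hβ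
  have hβ0 : 0 < β := B.hA₁pos _
  set r1 : ℝ → ℝ := fun X => deriv B.A₂ (X * B.h 1) / B.A₂ (X * B.h 1) with hr1
  set r2 : ℝ → ℝ := fun X => deriv (deriv B.A₂) (X * B.h 1) / B.A₂ (X * B.h 1) with hr2
  set q : ℝ → ℝ := fun X => r2 X - 2 * r1 X + 1 with hq
  set l : ℝ → ℝ := fun X => (2 * u + w) / β * r1 X - 2 * u / β + r1 X with hl
  have hat : Tendsto (fun X : ℝ => X * B.h 1) atTop atTop :=
    tendsto_id.atTop_mul_const B.h_one_pos
  have t1 : Tendsto r1 atTop (𝓝 1) := hA₂'.comp hat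
  have t2 : Tendsto r2 atTop (𝓝 1) := hA₂''.comp hat
  have cA : Continuous B.A₂ := B.A₂_cont
  have cA1 : Continuous (deriv B.A₂) :=
    continuous_iff_continuousAt.mpr fun y => (B.dA' y).continuousAt
  have cA2 : Continuous (deriv (deriv B.A₂)) :=
    continuous_iff_continuousAt.mpr fun y => B.dA'' y
  have c1 : Continuous r1 := (cA1.comp (by fun_prop)).div (cA.comp (by fun_prop))
    (fun X => (B.hA₂pos _).ne')
  have c2 : Continuous r2 := (cA2.comp (by fun_prop)).div (cA.comp (by fun_prop))
    (fun X => (B.hA₂pos _).ne')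
  have tq : Tendsto q atTop (𝓝 0) := by
    have := (t2.sub (t1.const_mul 2)).add_const 1
    norm_num at this
    exact this
  have tl : Tendsto l atTop (𝓝 ((2 * u + w) / β * 1 - 2 * u / β + 1)) :=
    ((t1.const_mul _).sub_const _).add t1
  have cq : Continuous q := by fun_prop
  have cl : Continuous l := by fun_prop
  obtain ⟨C1, hC1, hq1⟩ := bdd_of_tendsto cq.continuousOn tq
  obtain ⟨C2, hC2, hl2⟩ := bdd_of_tendsto cl.continuousOn tl
  refine ⟨fun X => X ^ 2 * q X + X * l X + (v + u) / β, fun X => ?_, fun M ε hM hε => ?_⟩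
  · have s0 := B.hgen X 1 (by simpa using B.hR)
    obtain ⟨s1, s2⟩ := hm X
    have hA0 := (B.hA₂pos (X * B.h 1)).ne'
    have := ((s2.add s1).sub (s1.mul_left (2 * X))).add (s0.mul_left (X ^ 2))
    convert this using 1
    · rfl
    · funext k; simp only [one_pow]; ring
    · simp only [hq, hl, hr1, hr2]
      rw [← hβ]
      field_simp
      ring
  · exact quad_small (C := max C1 C2) (le_max_of_le_left hC1) tq
      (fun X hX => (hq1 X hX).trans (le_max_left _ _))
      (fun X hX => (hl2 X hX).trans (le_max_right _ _)) hM hε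

/-- Theorem 2.1. -/
theorem stancuL_tendstoUniformlyOn (B : BrenkeData) (ν₁ ν₂ : ℝ) (hν₁ : 0 ≤ ν₁) (hν₂ : 0 ≤ ν₂)
    (f : ℝ → ℝ) (hf : ContinuousOn f (Set.Ici 0))
    (hfE : ∃ l : ℝ, Filter.Tendsto (fun x => f x / (1 + x ^ 2)) Filter.atTop (nhds l))
    (hA₂' : Filter.Tendsto (fun y => deriv B.A₂ y / B.A₂ y) Filter.atTop (nhds 1))
    (hA₂'' : Filter.Tendsto (fun y => deriv (deriv B.A₂) y / B.A₂ y) Filter.atTop (nhds 1))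
    (K : Set ℝ) (hK : K ⊆ Set.Ici 0) (hKc : IsCompact K) :
    TendstoUniformlyOn (fun (n : ℕ) (x : ℝ) => stancuL B ν₁ ν₂ n f x) f Filter.atTop K := by
  obtain ⟨V, hV, hVs⟩ := var_small B hA₂' hA₂''
  obtain ⟨M, hM0, hM⟩ : ∃ M : ℝ, 0 < M ∧ ∀ x ∈ K, x ≤ M := by
    obtain ⟨M, hM⟩ := hKc.bddAbove
    exact ⟨max M 1, lt_max_of_lt_right one_pos, fun x hx => (hM hx).trans (le_max_left _ _)⟩
  rw [Metric.tendstoUniformlyOn_iff]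
  intro ε0 hε0
  set ε := ε0 / 4 with hε_def
  have hε : 0 < ε := by positivity
  obtain ⟨C, hC0, hC⟩ := korovkin_bound (M := M) hf hfE hε
  obtain ⟨N, hN⟩ := hVs M (ε / (2 * C + 1)) hM0 (by positivity)
  set D := (ν₁ + ν₂ * M) ^ 2 with hD
  have hD0 : 0 ≤ D := by positivity
  obtain ⟨N2, hN2⟩ := exists_nat_ge (2 * C * D / ε)
  filter_upwards [eventually_ge_atTop N, eventually_ge_atTop N2, eventually_ge_atTop 1]
    with n hn hn2 hn1 x hxK
  have hn1' : (1 : ℝ) ≤ n := by exact_mod_cast hn1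
  have hn0 : (0 : ℝ) < n := by linarith
  have hx0 : 0 ≤ x := hK hxK
  have hxM := hM x hxK
  set X : ℝ := n * x with hX
  have hX0 : 0 ≤ X := by positivity
  have hVX := hN n hn X hX0 (by rw [hX]; gcongr)
  set S := B.A₁ (B.h 1) * B.A₂ (X * B.h 1) with hS
  have hS0 : 0 < S := mul_pos (B.hA₁pos _) (B.hA₂pos _)
  have s0 : HasSum (fun k => B.p k X) S := by
    have := B.hgen X 1 (by simpa using B.hR)
    simpa only [one_pow, mul_one] using this
  set T : ℕ → ℝ := fun k => ((k : ℝ) + ν₁) / (n + ν₂) with hT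
  have hnν : 0 < (n : ℝ) + ν₂ := by linarith
  have hT0 : ∀ k, 0 ≤ T k := fun k => by positivity
  have hTx : ∀ k, (T k - x) ^ 2 ≤ 2 * (((k : ℝ) - X) ^ 2 + D) / n ^ 2 := by
    intro k
    have e : T k - x = (((k : ℝ) - X) + (ν₁ - ν₂ * x)) / (n + ν₂) := by
      simp only [hT, hX]; field_simp; ring
    have h1 : (ν₁ - ν₂ * x) ^ 2 ≤ D := by
      have h2 : ν₂ * x ≤ ν₂ * M := by gcongr
      have h3 : 0 ≤ ν₂ * x := by positivity
      rw [hD]; apply sq_le_sq' <;> linarith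
    rw [e, div_pow]
    have h4 : (((k : ℝ) - X) + (ν₁ - ν₂ * x)) ^ 2 ≤ 2 * (((k : ℝ) - X) ^ 2 + D) := by
      nlinarith [sq_nonneg (((k : ℝ) - X) - (ν₁ - ν₂ * x))]
    have h5 : (n : ℝ) ^ 2 ≤ (n + ν₂) ^ 2 := by gcongr; linarith
    exact div_le_div₀ (by positivity) h4 (by positivity) h5
  have hfT : ∀ k, |f (T k) - f x| ≤ ε + C * (2 * (((k : ℝ) - X) ^ 2 + D) / n ^ 2) := by
    intro k
    refine (hC x (T k) hx0 hxM (hT0 k)).trans ?_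
    gcongr; exact hTx k
  -- dominating series
  have sG : HasSum (fun k => B.p k X * (ε + C * (2 * (((k : ℝ) - X) ^ 2 + D) / n ^ 2)))
      (S * (ε + 2 * C * D / n ^ 2) + S * V X * (2 * C / n ^ 2)) := by
    refine ((s0.mul_right (ε + 2 * C * D / n ^ 2)).add
      ((hV X).mul_right (2 * C / n ^ 2))).congr_fun ?_ |> fun h => h
    intro k; ring
  have hdom : ∀ k, ‖B.p k X * (f (T k) - f x)‖ ≤
      B.p k X * (ε + C * (2 * (((k : ℝ) - X) ^ 2 + D) / n ^ 2)) := by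
    intro k
    rw [norm_mul, Real.norm_eq_abs, abs_of_nonneg (B.hpos k X hX0), Real.norm_eq_abs]
    exact mul_le_mul_of_nonneg_left (hfT k) (B.hpos k X hX0)
  have sD : Summable (fun k => B.p k X * (f (T k) - f x)) :=
    Summable.of_norm_bounded sG.summable hdom
  have hbound : ‖∑' k, B.p k X * (f (T k) - f x)‖ ≤
      S * (ε + 2 * C * D / n ^ 2) + S * V X * (2 * C / n ^ 2) :=
    tsum_of_norm_bounded sG hdom
  have sF : HasSum (fun k => B.p k X * f (T k))
      (∑' k, B.p k X * (f (T k) - f x) + S * f x) := by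
    refine (sD.hasSum.add (s0.mul_right (f x))).congr_fun ?_ |> fun h => h
    intro k; ring
  have hL : stancuL B ν₁ ν₂ n f x - f x = S⁻¹ * ∑' k, B.p k X * (f (T k) - f x) := by
    have : stancuL B ν₁ ν₂ n f x = S⁻¹ * ∑' k, B.p k X * f (T k) := rfl
    rw [this, sF.tsum_eq]
    field_simp
    ring
  rw [dist_comm, Real.dist_eq, hL, abs_mul, abs_of_pos (inv_pos.mpr hS0)]
  rw [Real.norm_eq_abs] at hbound
  have h1 : S⁻¹ * |∑' k, B.p k X * (f (T k) - f x)| ≤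
      (ε + 2 * C * D / n ^ 2) + V X * (2 * C / n ^ 2) := by
    calc _ ≤ S⁻¹ * (S * (ε + 2 * C * D / n ^ 2) + S * V X * (2 * C / n ^ 2)) := by gcongr
      _ = _ := by field_simp
  have h2 : 2 * C * D / n ^ 2 ≤ ε := by
    have h3 : 2 * C * D / ε ≤ n := hN2.trans (by exact_mod_cast hn2)
    rw [div_le_iff₀ hε] at h3
    rw [div_le_iff₀ (by positivity)]
    nlinarith [mul_pos hε hn0]
  have h3 : V X * (2 * C / n ^ 2) ≤ ε := by
    calc V X * (2 * C / n ^ 2) ≤ (ε / (2 * C + 1) * n ^ 2) * (2 * C / n ^ 2) := by gcongr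
      _ = ε * (2 * C / (2 * C + 1)) := by field_simp
      _ ≤ ε * 1 := by
        gcongr
        rw [div_le_one (by positivity)]; linarith
      _ = ε := mul_one ε
  linarith
end

section
/- Let d ∈ ℕ, b ≥ 0, and let g_k^{d+1}(x,b) = Σ_{s=0}^{⌊k/(d+1)⌋} k!/(s!·(k−(d+1)s)!)·b^s·x^{k−(d+1)s} be the Gould-Hopper polynomials, which satisfy the generating relation e^{b t^{d+1}}·e^{xt} = Σ_{k=0}^∞ g_k^{d+1}(x,b)·t^k/k!. For ν₁, ν₂ ≥ 0 define the operators L_n^{(ν₁,ν₂)}(f; x) = e^{−nx−b} Σ_{k=0}^∞ [g_k^{d+1}(nx,b)/k!]·f((k+ν₁)/(n+ν₂)). Then for every continuous f : [0,∞) → ℝ with f(x)/(1+x²) convergent as x → ∞, L_n^{(ν₁,ν₂)}(f; x) → f(x) uniformly as n → ∞ on every compact subset of [0,∞). -/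
/-- The Gould-Hopper polynomials
`g_k^{d+1}(x,b) = ∑_{s=0}^{⌊k/(d+1)⌋} k!/(s!(k−(d+1)s)!) bˢ x^{k−(d+1)s}`. -/
noncomputable def gouldHopper (d : ℕ) (b : ℝ) (k : ℕ) (x : ℝ) : ℝ :=
  ∑ s ∈ Finset.range (k / (d + 1) + 1),
    (k.factorial : ℝ) / (s.factorial * (k - (d + 1) * s).factorial)
      * b ^ s * x ^ (k - (d + 1) * s)

/-- The Stancu type operators built from the Gould-Hopper polynomials:
`L_n^{(ν₁,ν₂)}(f;x) = e^{−nx−b} ∑ₖ g_k^{d+1}(nx,b)/k! · f((k+ν₁)/(n+ν₂))`. -/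
noncomputable def ghOp (d : ℕ) (b ν₁ ν₂ : ℝ) (n : ℕ) (f : ℝ → ℝ) (x : ℝ) : ℝ :=
  Real.exp (-(n * x) - b) *
    ∑' k : ℕ, gouldHopper d b k (n * x) / k.factorial * f ((k + ν₁) / (n + ν₂))

lemma gh_sq_le (u : ℝ) : u ^ 2 ≤ Real.exp u + Real.exp (-u) - 2 := by
  have h1 : (u/2)^2 ≤ (Real.sinh (u/2))^2 := by
    rw [sq_le_sq]
    rcases le_total 0 (u/2) with h | h
    · rw [abs_of_nonneg h, abs_of_nonneg (Real.sinh_nonneg_iff.2 h)]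
      exact Real.self_le_sinh_iff.2 h
    · rw [abs_of_nonpos h, abs_of_nonpos (Real.sinh_nonpos_iff.2 h)]
      linarith [Real.sinh_le_self_iff.2 h]
  have h2 : Real.exp u = Real.exp (u/2) * Real.exp (u/2) := by
    rw [← Real.exp_add]; ring_nf
  have h3 : Real.exp (-u) = Real.exp (-(u/2)) * Real.exp (-(u/2)) := by
    rw [← Real.exp_add]; ring_nf
  have h4 : Real.exp (u/2) * Real.exp (-(u/2)) = 1 := by
    rw [← Real.exp_add]; simp
  rw [Real.sinh_eq] at h1
  nlinarith

lemma gh_nonneg (d : ℕ) (b : ℝ) (hb : 0 ≤ b) (k : ℕ) (x : ℝ) (hx : 0 ≤ x) :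
    0 ≤ gouldHopper d b k x := by
  unfold gouldHopper
  exact Finset.sum_nonneg fun s _ => by positivity

/-- exponent of the exponential moment -/
noncomputable def ghExpo (d : ℕ) (b ν₁ ν₂ σ : ℝ) (n : ℕ) (x : ℝ) : ℝ :=
  (σ * (ν₁ / (n + ν₂)) + b * (Real.exp (σ / (n + ν₂)) ^ (d + 1) - 1))
    + x * (n * (Real.exp (σ / (n + ν₂)) - 1) - σ)

lemma gh_hasSum (d : ℕ) (b : ℝ)
    (hgen : ∀ x t : ℝ, HasSum (fun k : ℕ => gouldHopper d b k x * t ^ k / k.factorial)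
      (Real.exp (b * t ^ (d + 1)) * Real.exp (x * t)))
    (ν₁ ν₂ σ : ℝ) (n : ℕ) (x : ℝ) :
    HasSum (fun k : ℕ => Real.exp (-(n * x) - b) * (gouldHopper d b k (n * x) / k.factorial)
      * Real.exp (σ * ((k + ν₁) / (n + ν₂) - x))) (Real.exp (ghExpo d b ν₁ ν₂ σ n x)) := by
  have h := (hgen (n * x) (Real.exp (σ / (n + ν₂)))).mul_left
    (Real.exp (-(n * x) - b) * Real.exp (σ * (ν₁ / (n + ν₂)) - σ * x))
  convert h using 1
  · rfl
  · funext k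
    have : Real.exp (σ * ((k + ν₁) / (n + ν₂) - x))
        = Real.exp (σ * (ν₁ / (n + ν₂)) - σ * x) * Real.exp (σ / (n + ν₂)) ^ k := by
      rw [← Real.exp_nat_mul, ← Real.exp_add]
      congr 1
      ring
    rw [this]
    ring
  · rw [← Real.exp_add, ← Real.exp_add, ← Real.exp_add]
    congr 1
    unfold ghExpo
    ring

lemma gh_tendsto_inv (ν₂ : ℝ) (c : ℝ) :
    Filter.Tendsto (fun n : ℕ => c / ((n:ℝ) + ν₂)) Filter.atTop (nhds 0) :=
  tendsto_const_nhds.div_atTop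
    (Filter.tendsto_atTop_add_const_right _ _ tendsto_natCast_atTop_atTop)

lemma gh_tendsto_B (ν₂ σ : ℝ) (hσ : σ ≠ 0) :
    Filter.Tendsto (fun n : ℕ => (n:ℝ) * (Real.exp (σ / (n + ν₂)) - 1) - σ)
      Filter.atTop (nhds 0) := by
  have hpos : ∀ᶠ n : ℕ in Filter.atTop, 0 < (n:ℝ) + ν₂ :=
    (Filter.tendsto_atTop_add_const_right _ ν₂
      (tendsto_natCast_atTop_atTop (R := ℝ))).eventually_gt_atTop 0
  have h1 : Filter.Tendsto (fun n : ℕ => σ / ((n:ℝ) + ν₂)) Filter.atTop (nhdsWithin 0 {0}ᶜ) := by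
    refine tendsto_nhdsWithin_iff.2 ⟨gh_tendsto_inv ν₂ σ, ?_⟩
    filter_upwards [hpos] with n hn
    exact div_ne_zero hσ hn.ne'
  have h2 := (hasDerivAt_iff_tendsto_slope_zero.1 (Real.hasDerivAt_exp 0)).comp h1
  have h3 : Filter.Tendsto (fun n : ℕ => σ * (1 - ν₂ / ((n:ℝ) + ν₂))) Filter.atTop
      (nhds (σ * (1 - 0))) := (tendsto_const_nhds.sub (gh_tendsto_inv ν₂ ν₂)).const_mul σ
  have h4 := (h3.mul h2).sub_const σ
  simp only [Real.exp_zero, sub_zero, mul_one, sub_self] at h4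
  refine h4.congr' ?_
  filter_upwards [hpos] with n hn
  simp only [Function.comp, zero_add, smul_eq_mul]
  field_simp
  ring

lemma gh_tendsto_A (d : ℕ) (b ν₁ ν₂ σ : ℝ) :
    Filter.Tendsto (fun n : ℕ => σ * (ν₁ / ((n:ℝ) + ν₂))
      + b * (Real.exp (σ / (n + ν₂)) ^ (d + 1) - 1)) Filter.atTop (nhds 0) := by
  have h1 := (gh_tendsto_inv ν₂ ν₁).const_mul σ
  have h2 := ((((Real.continuous_exp.tendsto 0).comp (gh_tendsto_inv ν₂ σ)).pow (d+1)).sub_const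
    1).const_mul b
  simpa using h1.add h2

lemma gh_eventually (d : ℕ) (b ν₁ ν₂ σ : ℝ) (hσ : σ ≠ 0) (M : ℝ) (hM : 0 ≤ M) (η : ℝ)
    (hη : 0 < η) :
    ∀ᶠ n : ℕ in Filter.atTop, ∀ x, 0 ≤ x → x ≤ M →
      Real.exp (ghExpo d b ν₁ ν₂ σ n x) ≤ 1 + η := by
  have h := (gh_tendsto_A d b ν₁ ν₂ σ).abs.add ((gh_tendsto_B ν₂ σ hσ).abs.const_mul M)
  have h' := (Real.continuous_exp.tendsto _).comp h
  simp only [abs_zero, mul_zero, add_zero, Real.exp_zero] at h'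
  filter_upwards [h'.eventually_le_const (show (1:ℝ) < 1 + η by linarith)] with n hn x hx hxM
  refine le_trans (Real.exp_le_exp.2 ?_) hn
  unfold ghExpo
  refine add_le_add (le_abs_self _) ?_
  calc _ ≤ x * |(n:ℝ) * (Real.exp (σ / (n + ν₂)) - 1) - σ| := by gcongr; exact le_abs_self _
    _ ≤ _ := by gcongr

lemma gh_growth (f : ℝ → ℝ) (hf : ContinuousOn f (Set.Ici 0))
    (hfE : ∃ l : ℝ, Filter.Tendsto (fun x => f x / (1 + x ^ 2)) Filter.atTop (nhds l)) :
    ∃ C, 0 ≤ C ∧ ∀ y, 0 ≤ y → |f y| ≤ C * (1 + y ^ 2) := by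
  obtain ⟨l, hl⟩ := hfE
  obtain ⟨R, hR⟩ := Filter.eventually_atTop.1
    (hl.abs.eventually_le_const (show |l| < |l| + 1 by linarith))
  obtain ⟨D, hD⟩ := (isCompact_Icc (a := (0:ℝ)) (b := R)).exists_bound_of_continuousOn
    (hf.mono Set.Icc_subset_Ici_self)
  refine ⟨max (|l| + 1) D, le_max_of_le_left (by positivity), fun y hy => ?_⟩
  rcases le_total R y with h | h
  · have h1 := hR y h
    have hp : 0 < 1 + y ^ 2 := by positivity
    rw [abs_div, abs_of_pos hp, div_le_iff₀ hp] at h1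
    exact h1.trans (by gcongr; exact le_max_left _ _)
  · have h1 := hD y ⟨hy, h⟩
    rw [Real.norm_eq_abs] at h1
    have h2 := le_max_right (|l| + 1) D
    have h3 : 0 ≤ max (|l| + 1) D := le_max_of_le_left (by positivity)
    nlinarith [mul_nonneg h3 (sq_nonneg y)]

lemma gh_modulus (f : ℝ → ℝ) (hf : ContinuousOn f (Set.Ici 0))
    (hfE : ∃ l : ℝ, Filter.Tendsto (fun x => f x / (1 + x ^ 2)) Filter.atTop (nhds l))
    (M : ℝ) (ε : ℝ) (hε : 0 < ε) :
    ∃ C, 0 ≤ C ∧ ∀ x y, 0 ≤ x → x ≤ M → 0 ≤ y → |f y - f x| ≤ ε + C * (y - x) ^ 2 := by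
  obtain ⟨C, hC, hCf⟩ := gh_growth f hf hfE
  have huc := (isCompact_Icc (a := (0:ℝ)) (b := M + 1)).uniformContinuousOn_of_continuous
    (hf.mono Set.Icc_subset_Ici_self)
  obtain ⟨δ, hδ, hd⟩ := Metric.uniformContinuousOn_iff.1 huc ε hε
  set δ' := min δ 1 with hδ'
  have hδp : 0 < δ' := lt_min hδ one_pos
  refine ⟨C * ((2 + 3 * M ^ 2) / δ' ^ 2 + 2), by positivity, fun x y hx hxM hy => ?_⟩
  rcases lt_or_ge |y - x| δ' with h | h
  · have h1 : |y - x| < δ := h.trans_le (min_le_left _ _)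
    have h2 : |y - x| < 1 := h.trans_le (min_le_right _ _)
    have h3 := hd y ⟨hy, by linarith [(abs_lt.1 h2).2]⟩ x ⟨hx, by linarith⟩
      (by rwa [Real.dist_eq])
    rw [Real.dist_eq] at h3
    have : 0 ≤ C * ((2 + 3 * M ^ 2) / δ' ^ 2 + 2) * (y - x) ^ 2 := by positivity
    linarith
  · have h1 : δ' ^ 2 ≤ (y - x) ^ 2 := by
      rw [← sq_abs (y - x)]; gcongr
    have h2 : 2 + 3 * M ^ 2 ≤ (2 + 3 * M ^ 2) / δ' ^ 2 * (y - x) ^ 2 := by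
      rw [div_mul_eq_mul_div, le_div_iff₀ (by positivity)]
      gcongr
    have h3 : |f y - f x| ≤ |f y| + |f x| := abs_sub _ _
    have h4 := hCf y hy
    have h5 := hCf x hx
    have h6 : x ^ 2 ≤ M ^ 2 := by gcongr
    have h7 : (1 + y ^ 2) + (1 + x ^ 2) ≤ ((2 + 3 * M ^ 2) / δ' ^ 2 + 2) * (y - x) ^ 2 := by
      nlinarith [sq_nonneg (y - 2 * x)]
    have h8 := mul_le_mul_of_nonneg_left h7 hC
    nlinarith

/-- Example 3.1: for `b ≥ 0`, the Gould-Hopper operators converge uniformly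
to `f` on every compact subset of `[0,∞)`, for continuous `f` in the class `E`. -/
theorem ghOp_tendstoUniformlyOn (d : ℕ) (b : ℝ) (hb : 0 ≤ b)
    (hgen : ∀ x t : ℝ, HasSum (fun k : ℕ => gouldHopper d b k x * t ^ k / k.factorial)
      (Real.exp (b * t ^ (d + 1)) * Real.exp (x * t)))
    (ν₁ ν₂ : ℝ) (hν₁ : 0 ≤ ν₁) (hν₂ : 0 ≤ ν₂)
    (f : ℝ → ℝ) (hf : ContinuousOn f (Set.Ici 0))
    (hfE : ∃ l : ℝ, Filter.Tendsto (fun x => f x / (1 + x ^ 2)) Filter.atTop (nhds l))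
    (K : Set ℝ) (hK : K ⊆ Set.Ici 0) (hKc : IsCompact K) :
    TendstoUniformlyOn (fun (n : ℕ) (x : ℝ) => ghOp d b ν₁ ν₂ n f x) f Filter.atTop K := by
  obtain ⟨M₀, hM₀⟩ := hKc.bddAbove
  set M := max M₀ 0 with hMdef
  have hM : 0 ≤ M := le_max_right _ _
  rw [Metric.tendstoUniformlyOn_iff]
  intro ε hε
  obtain ⟨C, hC, hmod⟩ := gh_modulus f hf hfE M (ε / 2) (by positivity)
  set η := ε / (8 * (C + 1)) with hηdef
  have hη : 0 < η := by positivity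
  have hCη : C * (2 * η) < ε / 2 := by
    have : 8 * (C + 1) * η = ε := by rw [hηdef]; field_simp
    nlinarith
  filter_upwards [gh_eventually d b ν₁ ν₂ 1 one_ne_zero M hM η hη,
    gh_eventually d b ν₁ ν₂ (-1) (by norm_num) M hM η hη] with n hp hm x hxK
  have hx : 0 ≤ x := hK hxK
  have hxM : x ≤ M := (hM₀ hxK).trans (le_max_left _ _)
  have hp := hp x hx hxM
  have hm := hm x hx hxM
  set w : ℕ → ℝ := fun k =>
    Real.exp (-(n * x) - b) * (gouldHopper d b k (n * x) / k.factorial) with hw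
  have hw0 : ∀ k, 0 ≤ w k := fun k => by
    have := gh_nonneg d b hb k (n * x) (by positivity)
    simp only [hw]
    positivity
  set y : ℕ → ℝ := fun k => ((k:ℝ) + ν₁) / (n + ν₂) with hy
  have hs0 : HasSum w 1 := by
    have := gh_hasSum d b hgen ν₁ ν₂ 0 n x
    simpa [ghExpo] using this
  have hs1 := gh_hasSum d b hgen ν₁ ν₂ 1 n x
  have hs2 := gh_hasSum d b hgen ν₁ ν₂ (-1) n x
  have hS := (hs0.mul_left (ε / 2)).add (((hs1.add hs2).sub (hs0.mul_left 2)).mul_left C)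
  have hbound : ∀ k, ‖w k * (f (y k) - f x)‖ ≤ ε / 2 * w k
      + C * ((w k * Real.exp (1 * (y k - x)) + w k * Real.exp (-1 * (y k - x))) - 2 * w k) := by
    intro k
    have hyk : 0 ≤ y k := by simp only [hy]; positivity
    have h1 := hmod x (y k) hx hxM hyk
    have h2 := mul_le_mul_of_nonneg_left (gh_sq_le (y k - x)) hC
    rw [norm_mul, Real.norm_eq_abs, Real.norm_eq_abs, abs_of_nonneg (hw0 k)]
    have h3 := mul_le_mul_of_nonneg_left (h1.trans (add_le_add_right h2 _)) (hw0 k)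
    refine h3.trans (le_of_eq ?_)
    rw [one_mul, neg_one_mul]
    ring
  have hsum : Summable (fun k => w k * (f (y k) - f x)) :=
    Summable.of_norm_bounded hS.summable hbound
  have hle := tsum_of_norm_bounded hS hbound
  have hop : ghOp d b ν₁ ν₂ n f x = (∑' k, w k * (f (y k) - f x)) + f x := by
    have h := (hsum.hasSum.add (hs0.mul_right (f x))).tsum_eq
    rw [one_mul] at h
    rw [← h, ghOp, ← tsum_mul_left]
    refine tsum_congr fun k => ?_
    simp only [hw, hy]
    ring
  rw [dist_comm, Real.dist_eq, hop, add_sub_cancel_right, ← Real.norm_eq_abs]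
  refine hle.trans_lt ?_
  have : C * (Real.exp (ghExpo d b ν₁ ν₂ 1 n x) + Real.exp (ghExpo d b ν₁ ν₂ (-1) n x) - 2 * 1)
      ≤ C * (2 * η) := by
    gcongr
    linarith
  linarith
end
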